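/- Let E be a reflexive Banach space and let Ψ, Φ : E → ℝ be C¹ functionals satisfying (Ψ1)–(Ψ3) and (Φ1)–(Φ3). Then for each r > 0 the functional u ↦ Φ'(u)u / Ψ'(u)u attains its maximum on the set G_r = {u ∈ Ã_r : Φ(u) = max_{v ∈ Ã_r} Φ(v)}. -/

import Mathlib

open Filter Topology Set

variable {E : Type*}

/-- Weak (sequential) convergence in a normed space: `u n ⇀ u₀` iff `f (u n) → f u₀`
for every continuous linear functional `f`. -/
def WeakConv [NormedAddCommGroup E] [NormedSpace ℝ E] (u : ℕ → E) (u₀ : E) : Prop :=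
  ∀ f : E →L[ℝ] ℝ, Tendsto (fun n => f (u n)) atTop (𝓝 (f u₀))

open NormedSpace in
/-- In a reflexive space every bounded sequence has a weakly convergent subsequence. -/
lemma exists_weakConv_subseq [NormedAddCommGroup E] [NormedSpace ℝ E]
    (hrefl : Function.Surjective (inclusionInDoubleDual ℝ E))
    (u : ℕ → E) (hu : Bornology.IsBounded (range u)) :
    ∃ (u₀ : E) (φ : ℕ → ℕ), StrictMono φ ∧ WeakConv (u ∘ φ) u₀ := by
  set M : Submodule ℝ E := (Submodule.span ℝ (range u)).topologicalClosure with hM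
  have huM : range u ⊆ M := Submodule.subset_span.trans (Submodule.le_topologicalClosure _)
  have hsep : TopologicalSpace.IsSeparable (M : Set E) := by
    rw [hM, Submodule.topologicalClosure_coe]
    exact (countable_range u).isSeparable.span.closure
  have : TopologicalSpace.SeparableSpace M := hsep.separableSpace
  choose g hg hgd using fun k => exists_dual_vector'' ℝ (TopologicalSpace.denseSeq M k : E)
  have hg_sep : ∀ z ∈ M, z ≠ 0 → ∃ k, g k z ≠ 0 := by
    intro z hz hz0
    obtain ⟨k, hk⟩ := (TopologicalSpace.denseRange_denseSeq M).exists_dist_lt ⟨z, hz⟩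
      (half_pos (norm_pos_iff.2 hz0))
    refine ⟨k, fun hgz => ?_⟩
    set d : E := (TopologicalSpace.denseSeq M k : E) with hd
    have hk' : ‖z - d‖ < ‖z‖ / 2 := by
      rw [← dist_eq_norm]
      exact hk
    have hgk : ‖d‖ ≤ ‖z - d‖ := by
      calc ‖d‖ = -(g k (z - d)) := by rw [map_sub, hgz, hgd]; simp [hd]
        _ ≤ ‖g k (z - d)‖ := neg_le_abs _
        _ ≤ ‖z - d‖ := by simpa using (g k).le_of_opNorm_le (hg k) (z - d)
    have := norm_le_norm_sub_add z d
    linarith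
  set K : Set (WeakSpace ℝ E) := closure (toWeakSpace ℝ E '' range u) with hK
  have hKM : ∀ x ∈ K, (toWeakSpace ℝ E).symm x ∈ M := by
    have hcl : K ⊆ toWeakSpace ℝ E '' (M : Set E) := by
      rw [← (Submodule.isClosed_topologicalClosure (Submodule.span ℝ (range u))).closure_eq,
        M.convex.toWeakSpace_closure ℝ]
      exact closure_mono (image_mono huM)
    intro x hx
    obtain ⟨y, hy, rfl⟩ := hcl hx
    simpa using hy
  have hKc : IsCompact K := by
    refine isCompact_closure_of_isBounded ℝ E _ ?_ fun x _ => ?_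
    · rwa [preimage_image_eq _ (toWeakSpace ℝ E).injective]
    · obtain ⟨y, hy⟩ := hrefl (WeakDual.toStrongDual x)
      exact ⟨toWeakSpace ℝ E y, hy⟩
  have hcont (f : E →L[ℝ] ℝ) : Continuous fun x : WeakSpace ℝ E => f ((toWeakSpace ℝ E).symm x) :=
    WeakBilin.eval_continuous (topDualPairing ℝ E).flip f
  have : CompactSpace K := isCompact_iff_compactSpace.mp hKc
  have : TopologicalSpace.MetrizableSpace K :=
    Metric.PiNatEmbed.TopologicalSpace.MetrizableSpace.of_countable_separating
      (fun k (x : K) => g k ((toWeakSpace ℝ E).symm x))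
      (fun k => (hcont (g k)).comp continuous_subtype_val) fun x y hxy => by
        obtain ⟨k, hk⟩ := hg_sep _ (M.sub_mem (hKM x x.2) (hKM y y.2))
          (sub_ne_zero.2 ((toWeakSpace ℝ E).symm.injective.ne (Subtype.val_injective.ne hxy)))
        exact ⟨k, fun h => hk (by rw [map_sub, h, sub_self])⟩
  obtain ⟨x, φ, hφ, hx⟩ := CompactSpace.tendsto_subseq fun n =>
    (⟨toWeakSpace ℝ E (u n), subset_closure ⟨_, mem_range_self n, rfl⟩⟩ : K)
  exact ⟨(toWeakSpace ℝ E).symm x, φ, hφ, fun f =>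
    (((hcont f).comp continuous_subtype_val).tendsto x).comp hx⟩

/-- The direct method: a weakly sequentially upper semicontinuous function attains its maximum on
a nonempty weakly sequentially compact set. -/
lemma exists_forall_le_of_weakConv_subseq [NormedAddCommGroup E] [NormedSpace ℝ E]
    {S : Set E} (hne : S.Nonempty)
    (hS : ∀ u : ℕ → E, (∀ n, u n ∈ S) →
      ∃ u₀ ∈ S, ∃ φ : ℕ → ℕ, StrictMono φ ∧ WeakConv (u ∘ φ) u₀)
    {f : E → ℝ}
    (hf : ∀ (u : ℕ → E) (u₀ : E), (∀ n, u n ∈ S) → u₀ ∈ S → WeakConv u u₀ →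
      ∀ ε > (0 : ℝ), ∀ᶠ n in atTop, f (u n) < f u₀ + ε) :
    ∃ u₀ ∈ S, ∀ v ∈ S, f v ≤ f u₀ := by
  have hbdd : BddAbove (f '' S) := by
    by_contra h
    have hlarge (n : ℕ) : ∃ x ∈ S, (n : ℝ) < f x := by simpa using not_bddAbove_iff.1 h n
    choose u hu hun using hlarge
    obtain ⟨u₀, hu₀, φ, hφ, hconv⟩ := hS u hu
    have hnat := tendsto_natCast_atTop_atTop (R := ℝ).comp hφ.tendsto_atTop
    obtain ⟨n, hn, hn'⟩ := ((hf _ _ (fun n => hu (φ n)) hu₀ hconv 1 one_pos).and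
      (hnat.eventually_ge_atTop (f u₀ + 1))).exists
    have := hun (φ n)
    simp only [Function.comp_apply] at hn hn'
    linarith
  obtain ⟨a, -, ha, haS⟩ := exists_seq_tendsto_sSup (hne.image f) hbdd
  choose u hu hua using haS
  obtain ⟨u₀, hu₀, φ, hφ, hconv⟩ := hS u hu
  refine ⟨u₀, hu₀, fun v hv => (le_csSup hbdd (mem_image_of_mem f hv)).trans ?_⟩
  refine le_of_forall_pos_le_add fun ε hε => le_of_tendsto (ha.comp hφ.tendsto_atTop) ?_
  filter_upwards [hf _ _ (fun n => hu (φ n)) hu₀ hconv ε hε] with n hn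
  simpa [hua] using hn.le

/-- Proposition 1.5: under (Ψ1)–(Ψ3) and (Φ1)–(Φ3), the functional
`u ↦ Φ'(u)u / Ψ'(u)u` attains its maximum on `G_r`. -/
theorem quotient_max_attained_on_G [NormedAddCommGroup E] [NormedSpace ℝ E] [CompleteSpace E]
    (hrefl : Function.Surjective (NormedSpace.inclusionInDoubleDual ℝ E))
    (Ψ Φ : E → ℝ) (hΨC1 : ContDiff ℝ 1 Ψ) (hΦC1 : ContDiff ℝ 1 Φ)
    -- (Ψ1): Ψ is convex, coercive and weakly (sequentially) lower semicontinuous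
    (hΨconv : ConvexOn ℝ Set.univ Ψ)
    (hΨcoer : Tendsto Ψ (Bornology.cobounded E) atTop)
    (hΨwlsc : ∀ (u : ℕ → E) (u₀ : E), WeakConv u u₀ →
      ∀ ε > (0:ℝ), ∀ᶠ n in atTop, Ψ u₀ - ε < Ψ (u n))
    -- (Ψ2): Ã₀ = {0} and 0 ∈ int Ã_r for every r > 0
    (hΨ2a : {u : E | Ψ u ≤ 0} = {0})
    (hΨ2b : ∀ r > (0:ℝ), (0:E) ∈ interior {u : E | Ψ u ≤ r})
    -- (Ψ3): Ψ'(u)u ≠ 0 on every boundary ∂Ã_r, r > 0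
    (hΨ3 : ∀ r > (0:ℝ), ∀ u : E, Ψ u = r → fderiv ℝ Ψ u u ≠ 0)
    -- Φ is weakly (sequentially) upper semicontinuous
    (hΦwusc : ∀ (u : ℕ → E) (u₀ : E), WeakConv u u₀ →
      ∀ ε > (0:ℝ), ∀ᶠ n in atTop, Φ (u n) < Φ u₀ + ε)
    -- (Φ1), second part: u ↦ Φ'(u)u/Ψ'(u)u is weakly (sequentially) upper
    -- semicontinuous on E ∖ {0}
    (hQwusc : ∀ (u : ℕ → E) (u₀ : E), u₀ ≠ 0 → (∀ n, u n ≠ 0) → WeakConv u u₀ →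
      ∀ ε > (0:ℝ), ∀ᶠ n in atTop,
        fderiv ℝ Φ (u n) (u n) / fderiv ℝ Ψ (u n) (u n) <
          fderiv ℝ Φ u₀ u₀ / fderiv ℝ Ψ u₀ u₀ + ε)
    -- (Φ2): critical points of Φ have nonpositive Φ-value
    (hΦ2 : ∀ u : E, fderiv ℝ Φ u = 0 → Φ u ≤ 0)
    -- (Φ3): there is a sequence vₙ → 0 with Φ(vₙ) > 0
    (hΦ3 : ∃ v : ℕ → E, Tendsto v atTop (𝓝 0) ∧ ∀ n, 0 < Φ (v n))
    :
    ∀ r > (0:ℝ), ∃ u₀ : E, (Ψ u₀ ≤ r ∧ ∀ v : E, Ψ v ≤ r → Φ v ≤ Φ u₀) ∧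
      ∀ u : E, Ψ u ≤ r → (∀ v : E, Ψ v ≤ r → Φ v ≤ Φ u) →
        fderiv ℝ Φ u u / fderiv ℝ Ψ u u ≤ fderiv ℝ Φ u₀ u₀ / fderiv ℝ Ψ u₀ u₀ := by
  intro r hr
  have hsub (u : ℕ → E) (hu : ∀ n, Ψ (u n) ≤ r) :
      ∃ u₀, Ψ u₀ ≤ r ∧ ∃ φ : ℕ → ℕ, StrictMono φ ∧ WeakConv (u ∘ φ) u₀ := by
    have hbdd : Bornology.IsBounded {x | Ψ x ≤ r} := by
      rw [← Bornology.isCobounded_compl_iff]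
      filter_upwards [hΨcoer.eventually_gt_atTop r] with x hx
      simpa using hx
    obtain ⟨u₀, φ, hφ, hconv⟩ :=
      exists_weakConv_subseq hrefl u (hbdd.subset (range_subset_iff.2 hu))
    refine ⟨u₀, le_of_forall_pos_le_add fun ε hε => ?_, φ, hφ, hconv⟩
    obtain ⟨n, hn⟩ := (hΨwlsc _ _ hconv ε hε).exists
    have := hu (φ n)
    simp only [Function.comp_apply] at hn
    linarith
  obtain ⟨w, hw, hwmax⟩ := exists_forall_le_of_weakConv_subseq (S := {x | Ψ x ≤ r})
    ⟨0, interior_subset (hΨ2b r hr)⟩ hsub fun u u₀ _ _ => hΦwusc u u₀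
  have hne : ∀ u : E, (∀ v : E, Ψ v ≤ r → Φ v ≤ Φ u) → u ≠ 0 := by
    rintro u hu rfl
    have hnhds : ∀ᶠ x in 𝓝 (0 : E), Ψ x ≤ r := mem_interior_iff_mem_nhds.1 (hΨ2b r hr)
    have hmax : IsLocalMax Φ 0 := hnhds.mono hu
    obtain ⟨v, hv, hvpos⟩ := hΦ3
    obtain ⟨n, hn⟩ := (hv.eventually hnhds).exists
    linarith [hu _ hn, hvpos n, hΦ2 0 hmax.fderiv_eq_zero]
  obtain ⟨u₀, hu₀, hmax⟩ := exists_forall_le_of_weakConv_subseq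
    (S := {u | Ψ u ≤ r ∧ ∀ v : E, Ψ v ≤ r → Φ v ≤ Φ u})
    (f := fun u => fderiv ℝ Φ u u / fderiv ℝ Ψ u u) ⟨w, hw, hwmax⟩
    (fun u hu => by
      obtain ⟨u₀, hu₀, φ, hφ, hconv⟩ := hsub u fun n => (hu n).1
      refine ⟨u₀, ⟨hu₀, fun v hv => le_of_forall_pos_le_add fun ε hε => ?_⟩, φ, hφ, hconv⟩
      obtain ⟨n, hn⟩ := (hΦwusc _ _ hconv ε hε).exists
      exact ((hu (φ n)).2 v hv).trans hn.le)
    fun u u₀ hu hu₀ => hQwusc u u₀ (hne u₀ hu₀.2) fun n => hne _ (hu n).2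
  exact ⟨u₀, hu₀, fun u hu hu' => hmax u ⟨hu, hu'⟩⟩
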